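/- Let d ≥ 1 and n ≥ 1 be integers, 0 < α ≤ 1, and 1 ≤ i ≤ d. Let x, y, z ∈ ℝ^d be pairwise distinct, set a = y − x and b = z − y, and suppose |a| ≤ |b| ≤ |a+b| and a_i · b_i < 0. Then p^i_{α,n}(x,y,z) ≥ 2^{−(2n−1)} · b_i^{2(2n−1)} / (|b|^{2n−1+α} · |a+b|^{2n−1+α}). -/

import Mathlib

open scoped BigOperators

/-- The kernel `K^i_{α,n}(x) = x_i^{2n-1} / |x|^{2n-1+α}`. -/
noncomputable def Kker (d n : ℕ) (α : ℝ) (i : Fin d) (x : EuclideanSpace ℝ (Fin d)) : ℝ :=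
  (x i) ^ (2 * n - 1) / ‖x‖ ^ (2 * (n : ℝ) - 1 + α)

/-- The symmetrization (permutation) `p^i_{α,n}(x,y,z)`. -/
noncomputable def permI (d n : ℕ) (α : ℝ) (i : Fin d)
    (x y z : EuclideanSpace ℝ (Fin d)) : ℝ :=
  Kker d n α i (x - y) * Kker d n α i (x - z) +
    Kker d n α i (y - x) * Kker d n α i (y - z) +
    Kker d n α i (z - x) * Kker d n α i (z - y)

/-- Powers of two nonnegative summands: one of them is at least half of the sum. -/
lemma inv_two_pow_mul_add_pow_le (m : ℕ) {t u : ℝ} (ht : 0 ≤ t) (hu : 0 ≤ u) :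
    ((2 : ℝ) ^ m)⁻¹ * (t + u) ^ (2 * m) ≤
      t ^ m * (t + u) ^ m - t ^ m * u ^ m + u ^ m * (t + u) ^ m := by
  wlog h : u ≤ t generalizing t u
  · have := this hu ht (le_of_not_ge h)
    rw [add_comm u t] at this
    linarith
  have h1 : ((2 : ℝ) ^ m)⁻¹ * (t + u) ^ m ≤ t ^ m := by
    rw [← inv_pow, ← mul_pow]
    exact pow_le_pow_left₀ (by positivity) (by linarith) m
  have h2 : t ^ m ≤ (t + u) ^ m := pow_le_pow_left₀ ht (by linarith) m
  have h3 : ((2 : ℝ) ^ m)⁻¹ * (t + u) ^ m * (t + u) ^ m ≤ t ^ m * (t + u) ^ m :=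
    mul_le_mul_of_nonneg_right h1 (by positivity)
  have h4 : 0 ≤ u ^ m * ((t + u) ^ m - t ^ m) := mul_nonneg (by positivity) (by linarith)
  calc _ = ((2 : ℝ) ^ m)⁻¹ * (t + u) ^ m * (t + u) ^ m := by ring
    _ ≤ _ := by linarith

/-- Lower bound for the numerator of the permutation when the two increments have opposite
signs. -/
lemma numerator_lower_bound {m : ℕ} (hm : Odd m) {a b A B C : ℝ} (hab : a * b < 0)
    (hA : 0 ≤ A) (hAB : A ≤ B) (hBC : B ≤ C) :
    ((2 : ℝ) ^ m)⁻¹ * b ^ (2 * m) * A ≤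
      a ^ m * (a + b) ^ m * B - a ^ m * b ^ m * C + (a + b) ^ m * b ^ m * A := by
  wlog hb : 0 < b generalizing a b
  · have hb' : b ≠ 0 := by rintro rfl; simp at hab
    have := @this (-a) (-b) (by linarith) (by
      have := lt_of_le_of_ne (le_of_not_gt hb) hb'
      linarith)
    rw [← neg_add, hm.neg_pow, hm.neg_pow, hm.neg_pow, (even_two_mul m).neg_pow] at this
    linarith
  obtain ⟨t, rfl⟩ : ∃ t, a = -t := ⟨-a, by ring⟩
  have ht : 0 < t := by nlinarith
  have hB : 0 ≤ B := hA.trans hAB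
  rw [hm.neg_pow]
  rcases le_total t b with h | h
  · obtain ⟨u, rfl⟩ : ∃ u, b = t + u := ⟨b - t, by ring⟩
    have hu : 0 ≤ u := by linarith
    rw [neg_add_cancel_left]
    have h1 := mul_le_mul_of_nonneg_right (inv_two_pow_mul_add_pow_le m ht.le hu) hA
    have h2 : u ^ m ≤ (t + u) ^ m := pow_le_pow_left₀ hu (by linarith) m
    have h3 : 0 ≤ t ^ m * ((t + u) ^ m - u ^ m) * (B - A) :=
      mul_nonneg (mul_nonneg (by positivity) (by linarith)) (by linarith)
    have h4 : 0 ≤ t ^ m * (t + u) ^ m * (C - B) := mul_nonneg (by positivity) (by linarith)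
    linarith
  · obtain ⟨v, rfl⟩ : ∃ v, t = b + v := ⟨t - b, by ring⟩
    have hv : 0 ≤ v := by linarith
    rw [show -(b + v) + b = -v by ring, hm.neg_pow]
    have h1 : b ^ m ≤ (b + v) ^ m := pow_le_pow_left₀ hb.le h m
    have h2 : b ^ m * A ≤ (b + v) ^ m * B := mul_le_mul h1 hAB hA (by positivity)
    have h3 : 0 ≤ v ^ m * ((b + v) ^ m * B - b ^ m * A) :=
      mul_nonneg (by positivity) (by linarith)
    have h4 : b ^ m * A ≤ (b + v) ^ m * C := mul_le_mul h1 (hAB.trans hBC) hA (by positivity)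
    have h5 : 0 ≤ b ^ m * ((b + v) ^ m * C - b ^ m * A) :=
      mul_nonneg (by positivity) (by linarith)
    have h6 : ((2 : ℝ) ^ m)⁻¹ * (b ^ (2 * m) * A) ≤ b ^ (2 * m) * A :=
      mul_le_of_le_one_left (by positivity) (inv_le_one_of_one_le₀ (one_le_pow₀ one_le_two))
    have h7 : b ^ (2 * m) = b ^ m * b ^ m := by ring
    rw [h7] at h6 ⊢
    linarith

/-- The kernel is odd. -/
lemma Kker_sub_comm {d n : ℕ} (hn : 1 ≤ n) (α : ℝ) (i : Fin d)
    (x y : EuclideanSpace ℝ (Fin d)) : Kker d n α i (x - y) = -Kker d n α i (y - x) := by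
  have hm : Odd (2 * n - 1) := ⟨n - 1, by omega⟩
  rw [← neg_sub y x, Kker, Kker, norm_neg, PiLp.neg_apply, hm.neg_pow, neg_div]

/-- Case `a_i b_i < 0` in the lower bound of the symmetrization: if `x, y, z` are pairwise
distinct, `a = y - x`, `b = z - y`, `|a| ≤ |b| ≤ |a+b|` and `a_i b_i < 0`, then
`p^i_{α,n}(x,y,z) ≥ 2^{-(2n-1)} b_i^{2(2n-1)} / (|b|^{2n-1+α} |a+b|^{2n-1+α})`. -/
theorem stmt18 (d n : ℕ) (hd : 1 ≤ d) (hn : 1 ≤ n) (α : ℝ) (hα0 : 0 < α) (hα1 : α ≤ 1)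
    (i : Fin d) (x y z : EuclideanSpace ℝ (Fin d))
    (hxy : x ≠ y) (hyz : y ≠ z) (hxz : x ≠ z)
    (hab1 : ‖y - x‖ ≤ ‖z - y‖) (hab2 : ‖z - y‖ ≤ ‖z - x‖)
    (hsign : (y - x) i * (z - y) i < 0) :
    ((2 : ℝ) ^ (2 * n - 1))⁻¹ * ((z - y) i) ^ (2 * (2 * n - 1)) /
        (‖z - y‖ ^ (2 * (n : ℝ) - 1 + α) * ‖z - x‖ ^ (2 * (n : ℝ) - 1 + α)) ≤
      permI d n α i x y z := by
  have hm : Odd (2 * n - 1) := ⟨n - 1, by omega⟩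
  have hs : 0 ≤ 2 * (n : ℝ) - 1 + α := by
    have : (1 : ℝ) ≤ n := by exact_mod_cast hn
    linarith
  rw [permI, Kker_sub_comm hn α i x y, Kker_sub_comm hn α i x z, Kker_sub_comm hn α i y z]
  have hc : (z - x) i = (y - x) i + (z - y) i := by simp
  simp only [Kker]
  have hA : 0 < ‖y - x‖ ^ (2 * (n : ℝ) - 1 + α) :=
    Real.rpow_pos_of_pos (norm_pos_iff.2 (sub_ne_zero.2 hxy.symm)) _
  have hAB := Real.rpow_le_rpow (norm_nonneg _) hab1 hs
  have hBC := Real.rpow_le_rpow (norm_nonneg _) hab2 hs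
  have key := numerator_lower_bound hm hsign hA.le hAB hBC
  rw [← hc] at key
  have hB := hA.trans_le hAB
  have hC := hB.trans_le hBC
  generalize ‖y - x‖ ^ (2 * (n : ℝ) - 1 + α) = A at *
  generalize ‖z - y‖ ^ (2 * (n : ℝ) - 1 + α) = B at *
  generalize ‖z - x‖ ^ (2 * (n : ℝ) - 1 + α) = C at *
  generalize (y - x) i ^ (2 * n - 1) = p at *
  generalize (z - x) i ^ (2 * n - 1) = r at *
  generalize (z - y) i ^ (2 * (2 * n - 1)) = w at *
  generalize (z - y) i ^ (2 * n - 1) = q at *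
  calc _ = ((2 : ℝ) ^ (2 * n - 1))⁻¹ * w * A / (A * B * C) := by field_simp
    _ ≤ (p * r * B - p * q * C + r * q * A) / (A * B * C) := by gcongr
    _ = _ := by field_simp; ring
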